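/- Let ν > 0, m ≥ 1, n ≥ 1 and 0 ≤ θ ≤ ν/2. Let v : ℝ^d → ℝ^d be continuously differentiable with compact support and suppose: (i) the error inequality ν ∫_{Ω_F} |∇v|² dx + νm ∫_{Ω_S} |∇v|² dx + n ∫_{Ω_S} |v|² dx ≤ ∫_{Ω_S} f·v dx + ∫_Σ |g·v| d𝓗^{d−1} + θ ∫_Ω |∇v|² dx holds; (ii) the Poincaré inequality ∫_{Ω_S} |v|² dx ≤ C_P ∫_{Ω_S} |∇v|² dx holds for some C_P ≥ 0; (iii) the interpolation trace inequality ∫_Σ |v|² d𝓗^{d−1} ≤ C_T · (∫_{Ω_S} |∇v|² dx)^{1/2} · (∫_{Ω_S} |v|² dx)^{1/2} holds for some C_T ≥ 0. Then there is a constant C depending only on ν, C_P, C_T, ∫_{Ω_S} |f|² dx and ∫_Σ |g|² d𝓗^{d−1} (but not on m or n) such that (∫_{Ω_S} |∇v|² dx)^{1/2} ≤ C · (νm)^{-3/4} · n^{-1/4}. (This is estimate (mix:3) of Theorem 3, with v playing the role of u_{m,n} on the obstacle and θ the absorbed convective contribution under the smallness assumption on f.) -/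

import Mathlib

open MeasureTheory
open scoped RealInnerProductSpace

noncomputable section

/-- `|∇v|²(x) = ∑_{i,j} (∂_j v_i(x))²`. -/
def gradSq {d : ℕ} (v : EuclideanSpace ℝ (Fin d) → EuclideanSpace ℝ (Fin d))
    (x : EuclideanSpace ℝ (Fin d)) : ℝ :=
  ∑ j : Fin d, ‖fderiv ℝ v x (EuclideanSpace.single j 1)‖ ^ 2

/-- Cauchy–Schwarz in `L²`, assuming only that the squared norms are integrable. -/
theorem integral_abs_inner_le_sqrt_mul_sqrt {α E : Type*} [MeasurableSpace α] {μ : Measure α}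
    [NormedAddCommGroup E] [InnerProductSpace ℝ E] {f g : α → E}
    (hf : Integrable (fun x => ‖f x‖ ^ 2) μ) (hg : Integrable (fun x => ‖g x‖ ^ 2) μ) :
    ∫ x, |⟪f x, g x⟫| ∂μ ≤ √(∫ x, ‖f x‖ ^ 2 ∂μ) * √(∫ x, ‖g x‖ ^ 2 ∂μ) := by
  have memLp_norm {h : α → E} (hh : Integrable (fun x => ‖h x‖ ^ 2) μ) :
      MemLp (fun x => ‖h x‖) 2 μ := by
    refine (memLp_two_iff_integrable_sq ?_).2 hh
    have := hh.aestronglyMeasurable.aemeasurable.sqrt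
    simpa [Real.sqrt_sq] using this.aestronglyMeasurable
  have hf2 := memLp_norm hf
  have hg2 := memLp_norm hg
  calc ∫ x, |⟪f x, g x⟫| ∂μ ≤ ∫ x, ‖f x‖ * ‖g x‖ ∂μ :=
        integral_mono_of_nonneg (.of_forall fun x => abs_nonneg _) (hf2.integrable_mul hg2)
          (.of_forall fun x => abs_real_inner_le_norm _ _)
    _ ≤ _ := by
        have := integral_mul_le_Lp_mul_Lq_of_nonneg (μ := μ) (p := 2) (q := 2)
          Real.HolderConjugate.two_two (f := fun x => ‖f x‖) (g := fun x => ‖g x‖)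
          (.of_forall fun x => norm_nonneg _) (.of_forall fun x => norm_nonneg _)
          (by simpa using hf2) (by simpa using hg2)
        simpa [Real.sqrt_eq_rpow] using this

theorem gradSq_nonneg {d : ℕ} (v : EuclideanSpace ℝ (Fin d) → EuclideanSpace ℝ (Fin d))
    (x : EuclideanSpace ℝ (Fin d)) : 0 ≤ gradSq v x :=
  Finset.sum_nonneg fun _ _ => by positivity

theorem integrable_gradSq {d : ℕ} {v : EuclideanSpace ℝ (Fin d) → EuclideanSpace ℝ (Fin d)}
    (hv : ContDiff ℝ 1 v) (hc : HasCompactSupport v) : Integrable (gradSq v) := by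
  have hcont : Continuous (fderiv ℝ v) := hv.continuous_fderiv one_ne_zero
  refine Continuous.integrable_of_hasCompactSupport ?_ ?_
  · unfold gradSq
    fun_prop
  · refine (hc.fderiv (𝕜 := ℝ)).mono fun x hx => ?_
    contrapose! hx
    have : fderiv ℝ v x = 0 := by simpa using hx
    simp [gradSq, this]

/-- The scalar interpolation: the quadratic terms on the left absorb the geometric mean
`√(a * b)`. -/
theorem le_rpow_mul_rpow_of_sq_add_sq_le {M n K a b : ℝ} (hM : 0 < M) (hn : 0 < n) (hK : 0 ≤ K)
    (ha : 0 ≤ a) (hb : 0 ≤ b) (h : M / 2 * a ^ 2 + n * b ^ 2 ≤ K * √(a * b)) :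
    a ≤ 2 * K * (M ^ (-(3/4) : ℝ) * n ^ (-(1/4) : ℝ)) := by
  have hrhs : 0 ≤ 2 * K * (M ^ (-(3/4) : ℝ) * n ^ (-(1/4) : ℝ)) := by positivity
  rcases ha.eq_or_lt with rfl | ha
  · exact hrhs
  rcases hb.eq_or_lt with rfl | hb
  · have : 0 < M / 2 * a ^ 2 := by positivity
    simp at h
    linarith
  have hM4 : (M ^ (-(3/4) : ℝ)) ^ 4 = (M ^ 3)⁻¹ := by
    rw [← Real.rpow_natCast, ← Real.rpow_mul hM.le, ← Real.rpow_natCast, ← Real.rpow_neg hM.le]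
    norm_num
  have hn4 : (n ^ (-(1/4) : ℝ)) ^ 4 = n⁻¹ := by
    rw [← Real.rpow_natCast, ← Real.rpow_mul hn.le, ← Real.rpow_neg_one]
    norm_num
  refine le_of_pow_le_pow_left₀ (n := 4) (by norm_num) hrhs ?_
  have h1 : M / 2 * a ^ 2 ≤ K * √(a * b) := by nlinarith [sq_nonneg b]
  have h2 : n * b ^ 2 ≤ K * √(a * b) := by nlinarith [sq_nonneg a]
  have h3 : (M / 2 * a ^ 2) ^ 3 * (n * b ^ 2) ≤ (K * √(a * b)) ^ 3 * (K * √(a * b)) := by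
    gcongr
  have hs : √(a * b) ^ 2 = a * b := Real.sq_sqrt (by positivity)
  have h4 : (K * √(a * b)) ^ 3 * (K * √(a * b)) = K ^ 4 * (a * b) ^ 2 := by
    linear_combination K ^ 4 * (√(a * b) ^ 2 + a * b) * hs
  have h5 : M ^ 3 * n * a ^ 4 ≤ 8 * K ^ 4 := by
    refine le_of_mul_le_mul_right ?_ (by positivity : 0 < (a * b) ^ 2)
    rw [h4] at h3
    nlinarith
  rw [mul_pow, mul_pow (M ^ _), hM4, hn4, ← mul_inv, ← div_eq_mul_inv, le_div_iff₀ (by positivity)]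
  nlinarith [pow_nonneg hK 4]

/-- Estimate (mix:3) of Theorem 3: under the error inequality, the Poincaré
inequality on the obstacle and the interpolation trace inequality, the
`H¹`-seminorm of `v = u_{m,n}` on the obstacle is `O((νm)^{-3/4} n^{-1/4})`,
with a constant depending only on `ν`, `C_P`, `C_T`, `∫_{Ω_S} |f|²` and
`∫_Σ |g|²` (but not on `m` or `n`). -/
theorem mixed_penalization_obstacle_gradient_estimate
    (d : ℕ) (hd : 1 ≤ d) :
    ∃ C : ℝ → ℝ → ℝ → ℝ → ℝ → ℝ,
      ∀ (Ω ΩS Sig : Set (EuclideanSpace ℝ (Fin d))),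
        IsOpen Ω → Bornology.IsBounded Ω → MeasurableSet ΩS → ΩS ⊆ Ω →
        MeasurableSet Sig → μH[(d : ℝ) - 1] Sig < ⊤ →
      ∀ (f g v : EuclideanSpace ℝ (Fin d) → EuclideanSpace ℝ (Fin d)),
        IntegrableOn (fun x => ‖f x‖ ^ 2) ΩS →
        Integrable (fun x => ‖g x‖ ^ 2) (μH[(d : ℝ) - 1].restrict Sig) →
        ContDiff ℝ 1 v → HasCompactSupport v →
      ∀ (ν m n θ C_P C_T : ℝ),
        0 < ν → 1 ≤ m → 1 ≤ n → 0 ≤ θ → θ ≤ ν / 2 → 0 ≤ C_P → 0 ≤ C_T →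
        (ν * ∫ x in Ω \ ΩS, gradSq v x) + (ν * m * ∫ x in ΩS, gradSq v x)
            + (n * ∫ x in ΩS, ‖v x‖ ^ 2)
          ≤ (∫ x in ΩS, ⟪f x, v x⟫)
            + (∫ x in Sig, |⟪g x, v x⟫| ∂μH[(d : ℝ) - 1])
            + θ * ∫ x in Ω, gradSq v x →
        (∫ x in ΩS, ‖v x‖ ^ 2) ≤ C_P * ∫ x in ΩS, gradSq v x →
        (∫ x in Sig, ‖v x‖ ^ 2 ∂μH[(d : ℝ) - 1])
          ≤ C_T * Real.sqrt (∫ x in ΩS, gradSq v x)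
              * Real.sqrt (∫ x in ΩS, ‖v x‖ ^ 2) →
        Real.sqrt (∫ x in ΩS, gradSq v x)
          ≤ C ν C_P C_T (∫ x in ΩS, ‖f x‖ ^ 2)
              (∫ x in Sig, ‖g x‖ ^ 2 ∂μH[(d : ℝ) - 1])
            * ((ν * m) ^ (-(3/4) : ℝ) * n ^ (-(1/4) : ℝ)) := by
  refine ⟨fun _ C_P C_T F G => 2 * (√F * √√C_P + √G * √C_T), ?_⟩
  intro Ω ΩS Sig _ _ hS hsub _ hfin f g v hf hg hv hc ν m n θ C_P C_T hν hm hn _ hθ hCP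
    hCT herr hpoinc htrace
  have hgrad := integrable_gradSq hv hc
  have hvcont := hv.continuous
  have hvsq : Continuous fun x => ‖v x‖ ^ 2 := by fun_prop
  have hvsqc : HasCompactSupport fun x => ‖v x‖ ^ 2 :=
    hc.comp_left (g := fun y => ‖y‖ ^ 2) (by simp)
  have : IsFiniteMeasure (μH[(d : ℝ) - 1].restrict Sig) := ⟨by simpa using hfin⟩
  have hvS : IntegrableOn (fun x => ‖v x‖ ^ 2) ΩS :=
    (hvsq.integrable_of_hasCompactSupport hvsqc).integrableOn
  have hvSig : Integrable (fun x => ‖v x‖ ^ 2) (μH[(d : ℝ) - 1].restrict Sig) :=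
    hvsq.integrable_of_hasCompactSupport hvsqc
  have hfv : ∫ x in ΩS, ⟪f x, v x⟫ ≤ _ :=
    ((le_abs_self _).trans abs_integral_le_integral_abs).trans
      (integral_abs_inner_le_sqrt_mul_sqrt hf hvS)
  have hgv := integral_abs_inner_le_sqrt_mul_sqrt hg hvSig
  have hsplit : ∫ x in Ω, gradSq v x = (∫ x in Ω \ ΩS, gradSq v x) + ∫ x in ΩS, gradSq v x := by
    rw [setIntegral_sdiff hS hgrad.integrableOn hsub]
    ring
  have hA : 0 ≤ ∫ x in Ω \ ΩS, gradSq v x := integral_nonneg fun x => gradSq_nonneg v x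
  have hD : 0 ≤ ∫ x in ΩS, gradSq v x := integral_nonneg fun x => gradSq_nonneg v x
  have hV : 0 ≤ ∫ x in ΩS, ‖v x‖ ^ 2 := integral_nonneg fun x => by positivity
  rw [hsplit] at herr
  set A := ∫ x in Ω \ ΩS, gradSq v x
  set D := ∫ x in ΩS, gradSq v x
  set V := ∫ x in ΩS, ‖v x‖ ^ 2
  set F := ∫ x in ΩS, ‖f x‖ ^ 2
  set G := ∫ x in Sig, ‖g x‖ ^ 2 ∂μH[(d : ℝ) - 1]
  have hνm : 0 < ν * m := by positivity
  refine le_rpow_mul_rpow_of_sq_add_sq_le hνm (by linarith) (by positivity)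
    (Real.sqrt_nonneg D) (Real.sqrt_nonneg V) ?_
  rw [Real.sq_sqrt hD, Real.sq_sqrt hV]
  have hVab : √V ≤ √√C_P * √(√D * √V) := by
    rw [← Real.sqrt_mul (Real.sqrt_nonneg _), ← mul_assoc, ← Real.sqrt_mul hCP]
    refine Real.le_sqrt_of_sq_le ?_
    rw [sq]
    exact mul_le_mul_of_nonneg_right (Real.sqrt_le_sqrt hpoinc) (Real.sqrt_nonneg V)
  have hTab : √(∫ x in Sig, ‖v x‖ ^ 2 ∂μH[(d : ℝ) - 1]) ≤ √C_T * √(√D * √V) := by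
    rw [← Real.sqrt_mul hCT, ← mul_assoc]
    exact Real.sqrt_le_sqrt htrace
  have h1 := mul_le_mul_of_nonneg_left hVab (Real.sqrt_nonneg F)
  have h2 := mul_le_mul_of_nonneg_left hTab (Real.sqrt_nonneg G)
  have h3 : θ * (A + D) ≤ ν * A + ν * m / 2 * D := by
    have hA' : θ * A ≤ ν * A := mul_le_mul_of_nonneg_right (by linarith) hA
    have hD' : θ * D ≤ ν * m / 2 * D := mul_le_mul_of_nonneg_right (by nlinarith) hD
    linarith
  linarith
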